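/- arXiv:1709.00602 — 2 statements merged into one kernel-verified Lean document; each statement's English description precedes it below -/
import Mathlib

section
/- Let T > 0. For each k ≥ 1 there exist a₁ᵏ, a₂ᵏ ∈ C^∞(ℝ;[−1,1]) such that for every choice of bounded, uniformly continuous functions G_i : P×[0,T] → ℝ and F_{i,l} : P×[0,T]×[−1,1] → ℝ (i,l = 1,2) satisfying F_{i,l}(x,t,−1) = F_{i,l}(x,t,1) for all x ∈ P, t ∈ [0,T], the following convergences hold uniformly in (x,t) ∈ P×[0,T] as k → ∞: ∫₀ᵗ a₂ᵏ(s)( G₂(x,s) + F_{2,1}(x,s,a₁ᵏ(s)) + F_{2,2}(x,s,a₂ᵏ(s)) ) ds → (1/2) ∫₀ᵗ ( F_{2,1}(x,s,1) − F_{2,1}(x,s,0) ) ds, and ∫₀ᵗ a₁ᵏ(s)( G₁(x,s) + F_{1,1}(x,s,a₁ᵏ(s)) + F_{1,2}(x,s,a₂ᵏ(s)) ) ds → 0. -/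
noncomputable section

open MeasureTheory Real Set Filter Topology

abbrev E3 : Type := EuclideanSpace ℝ (Fin 3)

/-- The point of `ℝ³` with coordinates `(a, b, c)`. -/
def e3 (a b c : ℝ) : E3 := (EuclideanSpace.equiv (Fin 3) ℝ).symm ![a, b, c]

/-- Spatial partial derivative `∂ᵢ w`. -/
def pd3 (w : E3 → ℝ) (i : Fin 3) (x : E3) : ℝ := fderiv ℝ w x (EuclideanSpace.single i 1)

/-- Laplacian of a scalar function on `ℝ³`. -/
def lap3 (w : E3 → ℝ) (x : E3) : ℝ := ∑ i : Fin 3, pd3 (fun y => pd3 w i y) i x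

/-- Divergence of a vector field on `ℝ³`. -/
def div3 (u : E3 → E3) (x : E3) : ℝ := ∑ i : Fin 3, pd3 (fun y => u y i) i x

/-- `|∇u|²`. -/
def gradsq (u : E3 → E3) (x : E3) : ℝ :=
  ∑ i : Fin 3, ∑ j : Fin 3, (pd3 (fun y => u y j) i x) ^ 2

/-- The pressure function corresponding to a vector field `u`. -/
def pressureFn (u : E3 → E3) (x : E3) : ℝ :=
  ∫ y : E3, (∑ i : Fin 3, ∑ j : Fin 3,
    pd3 (fun z => u z j) i y * pd3 (fun z => u z i) j y) / (4 * π * ‖x - y‖)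

/-- Rotation about the `x₁` axis by angle `θ`. -/
def rot3 (θ : ℝ) (x : E3) : E3 :=
  e3 (x 0) (x 1 * Real.cos θ - x 2 * Real.sin θ) (x 1 * Real.sin θ + x 2 * Real.cos θ)

abbrev Pt : Type := ℝ × ℝ

/-- The open upper half-plane `P`. -/
def Pset : Set Pt := {p | 0 < p.2}

def pdx (g : Pt → ℝ) (p : Pt) : ℝ := fderiv ℝ g p (1, 0)

def pdy (g : Pt → ℝ) (p : Pt) : ℝ := fderiv ℝ g p (0, 1)

/-- The operator `L`, `Lg = Δg + ∂₂ g / x₂ - g / x₂²`. -/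
def Lop (g : Pt → ℝ) (p : Pt) : ℝ :=
  (pdx (fun q => pdx g q) p + pdy (fun q => pdy g q) p) + pdy g p / p.2 - g p / p.2 ^ 2

/-- `div (x₂ v(x₁,x₂))` for a planar vector field `v = (w₁, w₂)`. -/
def div2w (w₁ w₂ : Pt → ℝ) (p : Pt) : ℝ :=
  pdx (fun q => q.2 * w₁ q) p + pdy (fun q => q.2 * w₂ q) p

/-- `g ∈ C₀^∞(P)`. -/
def SmoothCompSuppP (g : Pt → ℝ) : Prop :=
  ContDiff ℝ (⊤ : ℕ∞) g ∧ HasCompactSupport g ∧ tsupport g ⊆ Pset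

/-- Distance to the `x₁`-axis. -/
def rad (x : E3) : ℝ := Real.sqrt ((x 1) ^ 2 + (x 2) ^ 2)

/-- The cylindrical projection `R⁻¹`. -/
def Rinv (x : E3) : Pt := (x 0, rad x)

/-- The rotation `R(V)` of a subset `V` of the (closed) upper half-plane. -/
def Rset (V : Set Pt) : Set E3 := {x | Rinv x ∈ V}

def wcomp (v₁ v₂ f : Pt → ℝ) (p : Pt) : ℝ := Real.sqrt (f p ^ 2 - (v₁ p ^ 2 + v₂ p ^ 2))

/-- The axisymmetric vector field `u[v,f]` determined (in cylindrical coordinates) by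
`u[v,f](x₁,x₂,0) = (v₁(x₁,x₂), v₂(x₁,x₂), √(f(x₁,x₂)² − |v(x₁,x₂)|²))` for `x₂ ≥ 0`. -/
def uvf (v₁ v₂ f : Pt → ℝ) (x : E3) : E3 :=
  e3 (v₁ (Rinv x))
    (v₂ (Rinv x) * (x 1 / rad x) - wcomp v₁ v₂ f (Rinv x) * (x 2 / rad x))
    (v₂ (Rinv x) * (x 2 / rad x) + wcomp v₁ v₂ f (Rinv x) * (x 1 / rad x))

/-- The planar pressure function `p[v,f]`, the restriction to `{x₃ = 0}` of the pressure
function `p*[v,f]` corresponding to `u[v,f]`. -/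
def pvf (v₁ v₂ f : Pt → ℝ) (q : Pt) : ℝ := pressureFn (uvf v₁ v₂ f) (e3 q.1 q.2 0)

def zf : Pt → ℝ := fun _ => 0

/-- First component of the pressure interaction function `F[v,f] = ∇p[0,f] − ∇p[v,f]`. -/
def Fpi1 (v₁ v₂ f : Pt → ℝ) (q : Pt) : ℝ := pdx (pvf zf zf f) q - pdx (pvf v₁ v₂ f) q

/-- Second component of the pressure interaction function `F[v,f] = ∇p[0,f] − ∇p[v,f]`. -/
def Fpi2 (v₁ v₂ f : Pt → ℝ) (q : Pt) : ℝ := pdy (pvf zf zf f) q - pdy (pvf v₁ v₂ f) q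

/-- A structure `(v, f, φ)` (with `v = (w₁,w₂)`) on a set `U ⋐ P`. -/
structure StructureOn (U : Set Pt) (w₁ w₂ f φ : Pt → ℝ) : Prop where
  smooth_w₁ : ContDiff ℝ (⊤ : ℕ∞) w₁
  smooth_w₂ : ContDiff ℝ (⊤ : ℕ∞) w₂
  smooth_f : ContDiff ℝ (⊤ : ℕ∞) f
  smooth_phi : ContDiff ℝ (⊤ : ℕ∞) φ
  hcs_w₁ : HasCompactSupport w₁
  hcs_w₂ : HasCompactSupport w₂
  hcs_f : HasCompactSupport f
  hcs_phi : HasCompactSupport φ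
  supp_w₁ : tsupport w₁ ⊆ {p | φ p = 1}
  supp_w₂ : tsupport w₂ ⊆ {p | φ p = 1}
  supp_f : tsupport f = closure U
  f_nonneg : ∀ p, 0 ≤ f p
  phi_mem : ∀ p, φ p ∈ Icc (0:ℝ) 1
  supp_phi : tsupport φ ⊆ U
  div_v : ∀ p ∈ U, div2w w₁ w₂ p = 0
  f_gt : ∀ p ∈ U, Real.sqrt (w₁ p ^ 2 + w₂ p ^ 2) < f p
  Lf_pos : ∀ p ∈ U, φ p ≠ 1 → 0 < Lop f p

/-- `u` is a weak solution of the Navier–Stokes inequality with viscosity `ν`: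
the local energy inequality holds against every nonnegative test function
`φ ∈ C₀^∞(ℝ³ × (0,∞))`. -/
def IsWeakNSI (ν : ℝ) (u : E3 → ℝ → E3) : Prop :=
  ∀ φ : E3 × ℝ → ℝ, ContDiff ℝ (⊤ : ℕ∞) φ → HasCompactSupport φ →
    tsupport φ ⊆ {z : E3 × ℝ | 0 < z.2} → (∀ z, 0 ≤ φ z) →
    2 * ν * (∫ t in Ioi (0:ℝ), ∫ x : E3, gradsq (fun y => u y t) x * φ (x, t)) ≤
      ∫ t in Ioi (0:ℝ), ∫ x : E3,
        (‖u x t‖ ^ 2 * (deriv (fun s => φ (x, s)) t + ν * lap3 (fun y => φ (y, t)) x)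
          + (‖u x t‖ ^ 2 + 2 * pressureFn (fun y => u y t) x) *
              (∑ i : Fin 3, u x t i * pd3 (fun y => φ (y, t)) i x))

/-- The regularity `sup_{t>0} ‖u(t)‖_{L²} < ∞` and `∇u ∈ L²(ℝ³ × (0,∞))`. -/
def NSIRegular (u : E3 → ℝ → E3) : Prop :=
  (∃ M : ℝ, ∀ t, 0 < t →
    Integrable (fun x : E3 => ‖u x t‖ ^ 2) ∧ (∫ x : E3, ‖u x t‖ ^ 2) ≤ M) ∧
  IntegrableOn (fun z : E3 × ℝ => gradsq (fun y => u y z.2) z.1) (univ ×ˢ Ioi 0)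

/-- `u` is unbounded in every neighbourhood of `(x₀, T₀)`. -/
def UnboundedNear (u : E3 → ℝ → E3) (x₀ : E3) (T₀ : ℝ) : Prop :=
  ∀ ε > 0, ∀ M : ℝ, ∃ x : E3, ∃ t : ℝ, 0 < t ∧ ‖x - x₀‖ < ε ∧ |t - T₀| < ε ∧ M < ‖u x t‖

/-- The singular set of `u`. -/
def SingularSet (u : E3 → ℝ → E3) : Set (E3 × ℝ) :=
  {z | 0 < z.2 ∧ UnboundedNear u z.1 z.2}

/-- `u · (∂_t u + (u·∇)u + ∇p)`, where `p` is the pressure corresponding to `u(·,t)`. -/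
def eulerOp (u : E3 → ℝ → E3) (x : E3) (t : ℝ) : ℝ :=
  ∑ j : Fin 3, u x t j *
    (deriv (fun s => u x s j) t
      + (∑ i : Fin 3, u x t i * pd3 (fun y => u y t j) i x)
      + pd3 (pressureFn (fun y => u y t)) j x)

/-- `u · (∂_t u − νΔu + (u·∇)u + ∇p)`, where `p` is the pressure corresponding to `u(·,t)`. -/
def nsOp (ν : ℝ) (u : E3 → ℝ → E3) (x : E3) (t : ℝ) : ℝ :=
  ∑ j : Fin 3, u x t j *
    (deriv (fun s => u x s j) t - ν * lap3 (fun y => u y t j) x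
      + (∑ i : Fin 3, u x t i * pd3 (fun y => u y t j) i x)
      + pd3 (pressureFn (fun y => u y t)) j x)

/-- The time-dependent modification `h_{1,t}` of `f₁`. -/
def h1d (f₁ φ₁ : Pt → ℝ) (δ t : ℝ) (p : Pt) : ℝ :=
  Real.sqrt (f₁ p ^ 2 - 2 * t * δ * φ₁ p)

/-- The time-dependent modification `h_{2,t}` of `f₂`. -/
def h2d (w₁ w₂ f₁ φ₁ b₁ b₂ f₂ φ₂ : Pt → ℝ) (δ t : ℝ) (p : Pt) : ℝ :=
  Real.sqrt (f₂ p ^ 2 - 2 * t * δ * φ₂ p +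
    ∫ s in (0:ℝ)..t,
      (b₁ p * Fpi1 w₁ w₂ (h1d f₁ φ₁ δ s) p + b₂ p * Fpi2 w₁ w₂ (h1d f₁ φ₁ δ s) p))

/-- The constant `D` of Lemma 3.4 (i). -/
def Dconst (w₁ : Pt → ℝ) : ℝ := (9 / (4 * π)) * ∫ y : E3, (w₁ (Rinv y)) ^ 2

/-- A (planar, open) rectangle. -/
def IsRect (V : Set Pt) : Prop :=
  ∃ a₁ b₁ a₂ b₂ : ℝ, a₁ < b₁ ∧ a₂ < b₂ ∧ V = Ioo a₁ b₁ ×ˢ Ioo a₂ b₂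

/-- If `f` is bounded by `1` with `c` as an antiperiod, its primitive is bounded. -/
theorem abs_integral_le_of_antiperiodic {f : ℝ → ℝ} {c : ℝ} (hc : 0 < c) (hf : Continuous f)
    (hanti : Function.Antiperiodic f c) (hb : ∀ s, |f s| ≤ 1) (t : ℝ) :
    |∫ s in (0:ℝ)..t, f s| ≤ 2 * c := by
  have hi : ∀ a b, IntervalIntegrable f volume a b := fun a b => hf.intervalIntegrable a b
  have hshift : ∀ u, ∫ s in (0:ℝ)..(u + c), f s
      = (∫ s in (0:ℝ)..c, f s) - ∫ s in (0:ℝ)..u, f s := by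
    intro u
    have h1 : ∫ s in c..(u + c), f s = - ∫ s in (0:ℝ)..u, f s := by
      have := intervalIntegral.integral_comp_add_right (a := 0) (b := u) f c
      rw [zero_add] at this
      rw [← this, ← intervalIntegral.integral_neg]
      exact intervalIntegral.integral_congr fun s _ => hanti s
    rw [← intervalIntegral.integral_add_adjacent_intervals (hi 0 c) (hi c (u + c)), h1]
    ring
  have hper : Function.Periodic (fun u => ∫ s in (0:ℝ)..u, f s) (2 * c) := by
    intro u
    have : u + 2 * c = u + c + c := by ring
    simp only [this, hshift]
    ring
  obtain ⟨u, hu, hut⟩ := hper.exists_mem_Ico₀ (by positivity) t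
  rw [hut]
  have := intervalIntegral.norm_integral_le_of_norm_le_const (a := 0) (b := u) (f := f) (C := 1)
    fun s _ => hb s
  rw [Real.norm_eq_abs, sub_zero, abs_of_nonneg hu.1, one_mul] at this
  exact this.trans hu.2.le

theorem abs_integral_comp_mul_le_of_antiperiodic {f : ℝ → ℝ} {c m : ℝ} (hc : 0 < c) (hm : 0 < m)
    (hf : Continuous f) (hanti : Function.Antiperiodic f c) (hb : ∀ s, |f s| ≤ 1) (t : ℝ) :
    |∫ s in (0:ℝ)..t, f (m * s)| ≤ 2 * c / m := by
  rw [intervalIntegral.integral_comp_mul_left f hm.ne', smul_eq_mul, abs_mul, mul_zero,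
    abs_of_pos (inv_pos.2 hm), div_eq_inv_mul]
  exact mul_le_mul_of_nonneg_left (abs_integral_le_of_antiperiodic hc hf hanti hb _)
    (inv_pos.2 hm).le

theorem integral_comp_mul_le_of_periodic {f : ℝ → ℝ} {c m T : ℝ} (hc : 0 < c) (hm : 1 ≤ m)
    (hT : 0 ≤ T) (hf : Continuous f) (hper : Function.Periodic f c) (hnn : ∀ s, 0 ≤ f s) :
    ∫ s in (0:ℝ)..T, f (m * s) ≤ (T / c + 1) * ∫ s in (0:ℝ)..c, f s := by
  have hm0 : 0 < m := by linarith
  have hI : 0 ≤ ∫ s in (0:ℝ)..c, f s :=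
    intervalIntegral.integral_nonneg hc.le fun s _ => hnn s
  set N : ℕ := ⌈m * T / c⌉₊
  have hNge : m * T ≤ N * c := by
    have := Nat.le_ceil (m * T / c)
    rwa [div_le_iff₀ hc] at this
  have hNle : (N : ℝ) ≤ m * T / c + 1 := (Nat.ceil_lt_add_one (by positivity)).le
  have h1 : ∫ s in (0:ℝ)..(m * T), f s ≤ ∫ s in (0:ℝ)..(N * c), f s :=
    intervalIntegral.integral_mono_interval le_rfl (by positivity) hNge
      (Filter.Eventually.of_forall hnn) (hf.intervalIntegrable _ _)
  have h2 : ∫ s in (0:ℝ)..(N * c), f s = N * ∫ s in (0:ℝ)..c, f s := by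
    have := hper.intervalIntegral_add_zsmul_eq (N : ℤ) 0 (fun a b => hf.intervalIntegrable a b)
    simpa using this
  rw [intervalIntegral.integral_comp_mul_left f hm0.ne', smul_eq_mul, mul_zero,
    inv_mul_le_iff₀ hm0]
  calc _ ≤ N * ∫ s in (0:ℝ)..c, f s := h1.trans h2.le
    _ ≤ (m * T / c + m) * ∫ s in (0:ℝ)..c, f s := by gcongr; linarith
    _ = _ := by ring

/-- A function with uniformly small primitive is almost orthogonal to a slowly varying one. -/
theorem abs_integral_mul_le_of_primitive_small {a g : ℝ → ℝ} {T δ η M e : ℝ} (hδ : 0 < δ)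
    (hM : 0 ≤ M)
    (ha : Continuous a) (ha1 : ∀ s, |a s| ≤ 1) (hprim : ∀ t, |∫ s in (0:ℝ)..t, a s| ≤ e)
    (hg : ContinuousOn g (Icc 0 T)) (hgM : ∀ s ∈ Icc 0 T, |g s| ≤ M)
    (hosc : ∀ s ∈ Icc 0 T, ∀ r ∈ Icc 0 T, |s - r| ≤ δ → |g s - g r| ≤ η) (n : ℕ) :
    ∀ t ∈ Icc 0 T, t ≤ n * δ → |∫ s in (0:ℝ)..t, a s * g s| ≤ η * t + n * (2 * M * e) := by
  have he : 0 ≤ e := (abs_nonneg _).trans (hprim 0)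
  induction n with
  | zero =>
    intro t ht htn
    have : t = 0 := le_antisymm (by simpa using htn) ht.1
    simp [this]
  | succ n ih =>
    intro t ht htn
    rcases le_or_gt t (n * δ) with h | h
    · refine (ih t ht h).trans ?_
      push_cast
      nlinarith [mul_nonneg hM he]
    set r : ℝ := n * δ with hr
    have hr0 : 0 ≤ r := by positivity
    have hrT : r ∈ Icc 0 T := ⟨hr0, h.le.trans ht.2⟩
    have hag : ContinuousOn (fun s => a s * g s) (Icc 0 T) := ha.continuousOn.mul hg
    have hsub1 : uIcc 0 r ⊆ Icc 0 T := by
      rw [uIcc_of_le hr0]; exact Icc_subset_Icc_right hrT.2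
    have hsub2 : uIcc r t ⊆ Icc 0 T := by
      rw [uIcc_of_le h.le]; exact Icc_subset_Icc hr0 ht.2
    have hi1 := (hag.mono hsub1).intervalIntegrable (μ := volume)
    have hi2 := (hag.mono hsub2).intervalIntegrable (μ := volume)
    have hi3 : IntervalIntegrable (fun s => a s * (g s - g r)) volume r t :=
      (ha.continuousOn.mul ((hg.mono hsub2).sub continuousOn_const)).intervalIntegrable
    have hi4 : IntervalIntegrable (fun s => g r * a s) volume r t :=
      (continuous_const.mul ha).intervalIntegrable _ _
    have hsplit : ∫ s in r..t, a s * g s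
        = (∫ s in r..t, a s * (g s - g r)) + g r * ∫ s in r..t, a s := by
      rw [← intervalIntegral.integral_const_mul, ← intervalIntegral.integral_add hi3 hi4]
      exact intervalIntegral.integral_congr fun s _ => by ring
    have hA : |∫ s in r..t, a s| ≤ 2 * e := by
      have := intervalIntegral.integral_interval_sub_left (ha.intervalIntegrable (μ := volume) 0 t)
        (ha.intervalIntegrable 0 r)
      rw [← this]
      have h1 := hprim t
      have h2 := hprim r
      rw [abs_le] at *
      constructor <;> linarith [h1.1, h1.2, h2.1, h2.2]
    have hB : |∫ s in r..t, a s * (g s - g r)| ≤ η * (t - r) := by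
      have := intervalIntegral.norm_integral_le_of_norm_le_const (a := r) (b := t)
        (f := fun s => a s * (g s - g r)) (C := η) (fun s hs => by
          rw [uIoc_of_le h.le] at hs
          have hsT : s ∈ Icc 0 T := ⟨hr0.trans hs.1.le, hs.2.trans ht.2⟩
          have h1 : |s - r| ≤ δ := by
            push_cast at htn
            rw [abs_of_nonneg (by linarith [hs.1])]
            linarith [hs.2]
          rw [Real.norm_eq_abs, abs_mul]
          calc _ ≤ 1 * η := mul_le_mul (ha1 s) (hosc s hsT r hrT h1) (abs_nonneg _) zero_le_one
            _ = η := one_mul _)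
      rwa [Real.norm_eq_abs, abs_of_pos (sub_pos.2 h)] at this
    have hC : |g r * ∫ s in r..t, a s| ≤ M * (2 * e) := by
      rw [abs_mul]
      exact mul_le_mul (hgM r hrT) hA (abs_nonneg _) hM
    rw [← intervalIntegral.integral_add_adjacent_intervals hi1 hi2, hsplit]
    have h0 := ih r hrT le_rfl
    push_cast
    calc _ ≤ |∫ s in (0:ℝ)..r, a s * g s| + (|∫ s in r..t, a s * (g s - g r)|
            + |g r * ∫ s in r..t, a s|) :=
          (abs_add_le _ _).trans (by gcongr; exact abs_add_le _ _)
      _ ≤ (η * r + n * (2 * M * e)) + (η * (t - r) + M * (2 * e)) := by gcongr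
      _ = _ := by ring

theorem UniformContinuousOn.add_fun {X : Type*} [UniformSpace X] {S : Set X} {f g : X → ℝ}
    (hf : UniformContinuousOn f S) (hg : UniformContinuousOn g S) :
    UniformContinuousOn (fun x => f x + g x) S := by
  rw [uniformContinuousOn_iff_restrict] at *
  exact UniformContinuous.add hf hg

theorem UniformContinuousOn.comp_prodMk_slice {X : Type*} {S : Set X} {g : X → ℝ → ℝ} {T : ℝ}
    [UniformSpace X]
    (hg : UniformContinuousOn (fun z : X × ℝ => g z.1 z.2) (S ×ˢ Icc (0:ℝ) T)) {x : X}
    (hx : x ∈ S) : ContinuousOn (g x) (Icc 0 T) :=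
  hg.continuousOn.comp (f := fun s : ℝ => (x, s)) (by fun_prop) fun _ hs => ⟨hx, hs⟩

/-- Weak convergence of `a k` to zero turns, up to an `L¹`-small error, the integrals of `Φ k`
into those of `L`, uniformly in the parameters. -/
theorem tendstoUniformlyOn_integral_of_oscillating {X : Type*} [PseudoMetricSpace X] {S : Set X}
    {T C M : ℝ} (hT : 0 ≤ T) {a β : ℕ → ℝ → ℝ} {e : ℕ → ℝ} {g L : X → ℝ → ℝ}
    {Φ : ℕ → X → ℝ → ℝ}
    (ha : ∀ k, Continuous (a k)) (ha1 : ∀ k s, |a k s| ≤ 1)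
    (hprim : ∀ k t, |∫ s in (0:ℝ)..t, a k s| ≤ e k) (he : Tendsto e atTop (𝓝 0))
    (hβ : ∀ k, Continuous (β k)) (hβ0 : ∀ k s, 0 ≤ β k s)
    (hβlim : Tendsto (fun k => ∫ s in (0:ℝ)..T, β k s) atTop (𝓝 0))
    (hg : UniformContinuousOn (fun z : X × ℝ => g z.1 z.2) (S ×ˢ Icc (0:ℝ) T))
    (hM : 0 ≤ M) (hC : 0 ≤ C) (hgM : ∀ x ∈ S, ∀ s ∈ Icc (0:ℝ) T, |g x s| ≤ M)
    (hΦ : ∀ k, ∀ x ∈ S, ContinuousOn (Φ k x) (Icc 0 T))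
    (hL : ∀ x ∈ S, ContinuousOn (L x) (Icc 0 T))
    (hclose : ∀ k, ∀ x ∈ S, ∀ s ∈ Icc (0:ℝ) T,
      |Φ k x s - L x s - a k s * g x s| ≤ C * β k s) :
    TendstoUniformlyOn (fun k (z : X × ℝ) => ∫ s in (0:ℝ)..z.2, Φ k z.1 s)
      (fun z => ∫ s in (0:ℝ)..z.2, L z.1 s) atTop (S ×ˢ Icc (0:ℝ) T) := by
  rw [Metric.tendstoUniformlyOn_iff]
  intro ε hε
  set η : ℝ := ε / 2 / (T + 1) with hη
  have hη0 : 0 < η := by positivity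
  obtain ⟨δ, hδ, hosc⟩ := Metric.uniformContinuousOn_iff.1 hg η hη0
  obtain ⟨n, hn⟩ := exists_nat_ge (T / (δ / 2))
  rw [div_le_iff₀ (by positivity)] at hn
  have hlim : Tendsto (fun k => n * (2 * M * e k) + C * ∫ s in (0:ℝ)..T, β k s) atTop (𝓝 0) := by
    have := ((he.const_mul (2 * M)).const_mul (n : ℝ)).add (hβlim.const_mul C)
    simpa using this
  filter_upwards [hlim.eventually (gt_mem_nhds (half_pos hε))] with k hk
  rintro ⟨x, t⟩ ⟨hx, ht⟩
  simp only at hx ht ⊢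
  have hgx := hg.comp_prodMk_slice hx
  have hmain := abs_integral_mul_le_of_primitive_small (a := a k) (g := g x) (T := T) (δ := δ / 2)
    (η := η) (M := M) (e := e k) (by positivity) hM (ha k) (ha1 k) (hprim k) hgx
    (hgM x hx) (fun s hs r hr hsr => by
      have := hosc (x, s) ⟨hx, hs⟩ (x, r) ⟨hx, hr⟩ (by
        rw [Prod.dist_eq, dist_self, Real.dist_eq]
        exact max_lt hδ (by linarith))
      exact this.le) n t ht (ht.2.trans hn)
  have hsub : uIcc 0 t ⊆ Icc 0 T := by
    rw [uIcc_of_le ht.1]; exact Icc_subset_Icc_right ht.2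
  have hi1 := ((hΦ k x hx).mono hsub).intervalIntegrable (μ := volume)
  have hi2 := ((hL x hx).mono hsub).intervalIntegrable (μ := volume)
  have hi3 : IntervalIntegrable (fun s => a k s * g x s) volume 0 t :=
    ((ha k).continuousOn.mul (hgx.mono hsub)).intervalIntegrable
  have heq : (∫ s in (0:ℝ)..t, Φ k x s) - ∫ s in (0:ℝ)..t, L x s
      = (∫ s in (0:ℝ)..t, (Φ k x s - L x s - a k s * g x s)) + ∫ s in (0:ℝ)..t, a k s * g x s := by
    rw [intervalIntegral.integral_sub (hi1.sub hi2) hi3, intervalIntegral.integral_sub hi1 hi2]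
    ring
  have herr : |∫ s in (0:ℝ)..t, (Φ k x s - L x s - a k s * g x s)|
      ≤ C * ∫ s in (0:ℝ)..T, β k s := by
    have h1 := intervalIntegral.norm_integral_le_of_norm_le (a := 0) (b := t) (μ := volume)
      (f := fun s => Φ k x s - L x s - a k s * g x s) (g := fun s => C * β k s) ht.1
      (Filter.Eventually.of_forall fun s hs => hclose k x hx s ⟨hs.1.le, hs.2.trans ht.2⟩)
      ((continuous_const.mul (hβ k)).intervalIntegrable _ _)
    rw [intervalIntegral.integral_const_mul] at h1
    refine h1.trans (mul_le_mul_of_nonneg_left ?_ hC)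
    exact intervalIntegral.integral_mono_interval le_rfl ht.1 ht.2
      (Filter.Eventually.of_forall (hβ0 k)) ((hβ k).intervalIntegrable _ _)
  rw [dist_comm, Real.dist_eq, heq]
  have hηt : η * t ≤ ε / 2 := by
    have : η * (T + 1) = ε / 2 := by rw [hη]; field_simp
    nlinarith [ht.2]
  calc _ ≤ _ := abs_add_le _ _
    _ ≤ C * (∫ s in (0:ℝ)..T, β k s) + (η * t + n * (2 * M * e k)) := add_le_add herr hmain
    _ < ε := by linarith

theorem tendsto_integral_div_one_add_sq_cos :
    Tendsto (fun k : ℕ => ∫ θ in (0:ℝ)..π, 2 / (1 + (((k : ℝ) + 1) * Real.cos (2 * θ)) ^ 2))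
      atTop (𝓝 0) := by
  have hcount : {θ : ℝ | Real.cos (2 * θ) = 0}.Countable := by
    refine (countable_range fun n : ℤ => (2 * (n : ℝ) + 1) * π / 4).mono ?_
    intro θ hθ
    obtain ⟨n, hn⟩ := Real.cos_eq_zero_iff.1 hθ
    exact ⟨n, by simp only; linarith⟩
  have hae : ∀ᵐ θ : ℝ, Real.cos (2 * θ) ≠ 0 := by
    rw [ae_iff]
    simpa using hcount.measure_zero volume
  have := intervalIntegral.tendsto_integral_filter_of_dominated_convergence (μ := volume)
    (a := 0) (b := π) (l := atTop) (f := fun _ => (0:ℝ)) (fun _ => (2:ℝ))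
    (F := fun (k : ℕ) θ => 2 / (1 + (((k : ℝ) + 1) * Real.cos (2 * θ)) ^ 2))
    (Filter.Eventually.of_forall fun k => by
      refine Continuous.aestronglyMeasurable ?_
      exact continuous_const.div (by fun_prop) fun θ => by positivity)
    (Filter.Eventually.of_forall fun k => Filter.Eventually.of_forall fun θ _ => by
      rw [Real.norm_eq_abs, abs_of_nonneg (by positivity)]
      exact div_le_self (by norm_num) (by linarith [sq_nonneg (((k : ℝ) + 1) * Real.cos (2 * θ))]))
    intervalIntegrable_const
    (hae.mono fun θ hθ _ => by
      refine tendsto_const_nhds.div_atTop (tendsto_atTop_add_const_left _ _ ?_)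
      simp only [mul_pow]
      refine Tendsto.atTop_mul_const (by positivity) ?_
      exact (tendsto_pow_atTop two_ne_zero).comp
        (tendsto_atTop_add_const_right _ _ tendsto_natCast_atTop_atTop))
  simpa using this

/-- A smooth odd approximation of the sign function, exact outside `(-1, 1)`. -/
def smoothSign (x : ℝ) : ℝ := smoothTransition x - smoothTransition (-x)

theorem smoothSign_contDiff : ContDiff ℝ (⊤ : ℕ∞) smoothSign :=
  smoothTransition.contDiff.sub (smoothTransition.contDiff.comp contDiff_neg)

theorem smoothSign_neg (x : ℝ) : smoothSign (-x) = -smoothSign x := by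
  simp [smoothSign]

theorem smoothSign_of_one_le {x : ℝ} (hx : 1 ≤ x) : smoothSign x = 1 := by
  rw [smoothSign, smoothTransition.one_of_one_le hx, smoothTransition.zero_of_nonpos (by linarith),
    sub_zero]

theorem smoothSign_of_le_neg_one {x : ℝ} (hx : x ≤ -1) : smoothSign x = -1 := by
  rw [← neg_neg x, smoothSign_neg, smoothSign_of_one_le (by linarith)]

theorem abs_smoothSign_le_one (x : ℝ) : |smoothSign x| ≤ 1 := by
  rw [smoothSign, abs_le]
  constructor <;> linarith [smoothTransition.nonneg x, smoothTransition.le_one x,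
    smoothTransition.nonneg (-x), smoothTransition.le_one (-x)]

/-- Periodic profile of the first process: close to `sign (cos θ)` where `cos (2θ) > 0`, and to
`0` where `cos (2θ) < 0`. -/
def profileOne (m θ : ℝ) : ℝ :=
  smoothTransition (m * Real.cos (2 * θ)) * smoothSign (2 * Real.cos θ)

/-- Periodic profile of the second process: a smooth approximation of `sign (cos (2θ))`. -/
def profileTwo (m θ : ℝ) : ℝ := smoothSign (m * Real.cos (2 * θ))

theorem profileOne_contDiff (m : ℝ) : ContDiff ℝ (⊤ : ℕ∞) (profileOne m) := by
  unfold profileOne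
  exact (smoothTransition.contDiff.comp (by fun_prop)).mul (smoothSign_contDiff.comp (by fun_prop))

theorem profileTwo_contDiff (m : ℝ) : ContDiff ℝ (⊤ : ℕ∞) (profileTwo m) := by
  unfold profileTwo
  exact smoothSign_contDiff.comp (by fun_prop)

theorem abs_profileOne_le_one (m θ : ℝ) : |profileOne m θ| ≤ 1 := by
  rw [profileOne, abs_mul, abs_of_nonneg (smoothTransition.nonneg _)]
  exact mul_le_one₀ (smoothTransition.le_one _) (abs_nonneg _) (abs_smoothSign_le_one _)

theorem abs_profileTwo_le_one (m θ : ℝ) : |profileTwo m θ| ≤ 1 := abs_smoothSign_le_one _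

theorem profileOne_antiperiodic (m : ℝ) : Function.Antiperiodic (profileOne m) π := by
  intro θ
  have h : 2 * (θ + π) = 2 * θ + 2 * π := by ring
  rw [profileOne, profileOne, h, Real.cos_add_two_pi, Real.cos_add_pi, mul_neg, smoothSign_neg,
    mul_neg]

theorem profileTwo_antiperiodic (m : ℝ) : Function.Antiperiodic (profileTwo m) (π / 2) := by
  intro θ
  have h : 2 * (θ + π / 2) = 2 * θ + π := by ring
  rw [profileTwo, profileTwo, h, Real.cos_add_pi, mul_neg, smoothSign_neg]

theorem profile_values {m θ : ℝ} (hm : 0 < m) (h : 1 ≤ |m * Real.cos (2 * θ)|) :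
    (profileTwo m θ = 1 ∧ (profileOne m θ = 1 ∨ profileOne m θ = -1)) ∨
      (profileTwo m θ = -1 ∧ profileOne m θ = 0) := by
  rcases le_abs.1 h with h | h
  · left
    refine ⟨smoothSign_of_one_le h, ?_⟩
    have hc : 0 < Real.cos (2 * θ) := pos_of_mul_pos_right (by linarith) hm.le
    rw [Real.cos_two_mul] at hc
    have h2 : 1 ≤ |2 * Real.cos θ| := by
      rw [← one_le_sq_iff_one_le_abs]
      nlinarith
    rw [profileOne, smoothTransition.one_of_one_le h, one_mul]
    rcases le_abs.1 h2 with h2 | h2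
    · exact Or.inl (smoothSign_of_one_le h2)
    · exact Or.inr (smoothSign_of_le_neg_one (by linarith))
  · right
    refine ⟨smoothSign_of_le_neg_one (by linarith), ?_⟩
    rw [profileOne, smoothTransition.zero_of_nonpos (by linarith), zero_mul]

/-- Theorem 3.7: existence of the oscillatory processes. -/
theorem statement_12 (T : ℝ) (hT : 0 < T) :
    ∃ a₁ a₂ : ℕ → ℝ → ℝ,
      (∀ k : ℕ, ContDiff ℝ (⊤ : ℕ∞) (a₁ k) ∧ ContDiff ℝ (⊤ : ℕ∞) (a₂ k) ∧
        (∀ s, a₁ k s ∈ Icc (-1:ℝ) 1) ∧ (∀ s, a₂ k s ∈ Icc (-1:ℝ) 1)) ∧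
      ∀ (G₁ G₂ : Pt → ℝ → ℝ) (F₁₁ F₁₂ F₂₁ F₂₂ : Pt → ℝ → ℝ → ℝ),
        (∃ M : ℝ, ∀ x ∈ Pset, ∀ t ∈ Icc (0:ℝ) T,
          |G₁ x t| ≤ M ∧ |G₂ x t| ≤ M ∧
          ∀ a ∈ Icc (-1:ℝ) 1,
            |F₁₁ x t a| ≤ M ∧ |F₁₂ x t a| ≤ M ∧ |F₂₁ x t a| ≤ M ∧ |F₂₂ x t a| ≤ M) →
        UniformContinuousOn (fun z : Pt × ℝ => G₁ z.1 z.2) (Pset ×ˢ Icc (0:ℝ) T) →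
        UniformContinuousOn (fun z : Pt × ℝ => G₂ z.1 z.2) (Pset ×ˢ Icc (0:ℝ) T) →
        UniformContinuousOn (fun z : (Pt × ℝ) × ℝ => F₁₁ z.1.1 z.1.2 z.2)
          ((Pset ×ˢ Icc (0:ℝ) T) ×ˢ Icc (-1:ℝ) 1) →
        UniformContinuousOn (fun z : (Pt × ℝ) × ℝ => F₁₂ z.1.1 z.1.2 z.2)
          ((Pset ×ˢ Icc (0:ℝ) T) ×ˢ Icc (-1:ℝ) 1) →
        UniformContinuousOn (fun z : (Pt × ℝ) × ℝ => F₂₁ z.1.1 z.1.2 z.2)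
          ((Pset ×ˢ Icc (0:ℝ) T) ×ˢ Icc (-1:ℝ) 1) →
        UniformContinuousOn (fun z : (Pt × ℝ) × ℝ => F₂₂ z.1.1 z.1.2 z.2)
          ((Pset ×ˢ Icc (0:ℝ) T) ×ˢ Icc (-1:ℝ) 1) →
        (∀ x ∈ Pset, ∀ t ∈ Icc (0:ℝ) T,
          F₁₁ x t (-1) = F₁₁ x t 1 ∧ F₁₂ x t (-1) = F₁₂ x t 1 ∧
          F₂₁ x t (-1) = F₂₁ x t 1 ∧ F₂₂ x t (-1) = F₂₂ x t 1) →
        TendstoUniformlyOn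
          (fun (k : ℕ) (z : Pt × ℝ) =>
            ∫ s in (0:ℝ)..z.2, a₂ k s * (G₂ z.1 s + F₂₁ z.1 s (a₁ k s) + F₂₂ z.1 s (a₂ k s)))
          (fun z : Pt × ℝ =>
            (1 / 2) * ∫ s in (0:ℝ)..z.2, (F₂₁ z.1 s 1 - F₂₁ z.1 s 0))
          atTop (Pset ×ˢ Icc (0:ℝ) T) ∧
        TendstoUniformlyOn
          (fun (k : ℕ) (z : Pt × ℝ) =>
            ∫ s in (0:ℝ)..z.2, a₁ k s * (G₁ z.1 s + F₁₁ z.1 s (a₁ k s) + F₁₂ z.1 s (a₂ k s)))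
          (fun _ : Pt × ℝ => 0)
          atTop (Pset ×ˢ Icc (0:ℝ) T) := by
  have hm1 : ∀ k : ℕ, (1 : ℝ) ≤ (k : ℝ) + 1 := fun k => by
    linarith [(Nat.cast_nonneg k : (0 : ℝ) ≤ k)]
  have hm0 : ∀ k : ℕ, (0 : ℝ) < (k : ℝ) + 1 := fun k => by positivity
  set a₁ : ℕ → ℝ → ℝ := fun k s => profileOne ((k : ℝ) + 1) (((k : ℝ) + 1) * s)
  set a₂ : ℕ → ℝ → ℝ := fun k s => profileTwo ((k : ℝ) + 1) (((k : ℝ) + 1) * s)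
  set B : ℕ → ℝ → ℝ := fun k θ => 2 / (1 + (((k : ℝ) + 1) * Real.cos (2 * θ)) ^ 2) with hB
  set β : ℕ → ℝ → ℝ := fun k s => B k (((k : ℝ) + 1) * s) with hβ
  have hd₁ : ∀ k, ContDiff ℝ (⊤ : ℕ∞) (a₁ k) := fun k =>
    (profileOne_contDiff _).comp (contDiff_const.mul contDiff_id)
  have hd₂ : ∀ k, ContDiff ℝ (⊤ : ℕ∞) (a₂ k) := fun k =>
    (profileTwo_contDiff _).comp (contDiff_const.mul contDiff_id)
  have hc₁ : ∀ k, Continuous (a₁ k) := fun k => (hd₁ k).continuous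
  have hc₂ : ∀ k, Continuous (a₂ k) := fun k => (hd₂ k).continuous
  have hb₁ : ∀ k s, |a₁ k s| ≤ 1 := fun k s => abs_profileOne_le_one _ _
  have hb₂ : ∀ k s, |a₂ k s| ≤ 1 := fun k s => abs_profileTwo_le_one _ _
  have hI₁ : ∀ k s, a₁ k s ∈ Icc (-1:ℝ) 1 := fun k s => abs_le.1 (hb₁ k s)
  have hI₂ : ∀ k s, a₂ k s ∈ Icc (-1:ℝ) 1 := fun k s => abs_le.1 (hb₂ k s)
  have hp₁ : ∀ k t, |∫ s in (0:ℝ)..t, a₁ k s| ≤ 2 * π / ((k : ℝ) + 1) := fun k t =>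
    abs_integral_comp_mul_le_of_antiperiodic Real.pi_pos (hm0 k)
      (profileOne_contDiff _).continuous (profileOne_antiperiodic _) (abs_profileOne_le_one _) t
  have hp₂ : ∀ k t, |∫ s in (0:ℝ)..t, a₂ k s| ≤ 2 * (π / 2) / ((k : ℝ) + 1) := fun k t =>
    abs_integral_comp_mul_le_of_antiperiodic Real.pi_div_two_pos (hm0 k)
      (profileTwo_contDiff _).continuous (profileTwo_antiperiodic _) (abs_profileTwo_le_one _) t
  have hlim : ∀ c : ℝ, Tendsto (fun k : ℕ => c / ((k : ℝ) + 1)) atTop (𝓝 0) := fun c =>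
    tendsto_const_nhds.div_atTop (tendsto_atTop_add_const_right _ _ tendsto_natCast_atTop_atTop)
  have hBc : ∀ k, Continuous (B k) := fun k =>
    continuous_const.div (by fun_prop) fun θ => by positivity
  have hB0 : ∀ k θ, 0 ≤ B k θ := fun k θ => by simp only [hB]; positivity
  have hβc : ∀ k, Continuous (β k) := fun k => (hBc k).comp (by fun_prop)
  have hβ0 : ∀ k s, 0 ≤ β k s := fun k s => hB0 k _
  have hBper : ∀ k, Function.Periodic (B k) π := fun k θ => by
    have h : 2 * (θ + π) = 2 * θ + 2 * π := by ring
    simp only [hB, h, Real.cos_add_two_pi]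
  have hβlim : Tendsto (fun k => ∫ s in (0:ℝ)..T, β k s) atTop (𝓝 0) := by
    refine squeeze_zero (fun k => intervalIntegral.integral_nonneg hT.le fun s _ => hβ0 k s)
      (fun k => integral_comp_mul_le_of_periodic Real.pi_pos (hm1 k) hT.le (hBc k) (hBper k)
        (hB0 k)) ?_
    simpa using tendsto_integral_div_one_add_sq_cos.const_mul (T / π + 1)
  have hcases : ∀ k s, 1 ≤ β k s ∨ (a₂ k s = 1 ∧ (a₁ k s = 1 ∨ a₁ k s = -1)) ∨
      (a₂ k s = -1 ∧ a₁ k s = 0) := by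
    intro k s
    rcases le_total 1 |((k : ℝ) + 1) * Real.cos (2 * (((k : ℝ) + 1) * s))| with h | h
    · exact Or.inr (profile_values (hm0 k) h)
    · left
      rw [← sq_le_one_iff_abs_le_one] at h
      simp only [hβ, hB]
      rw [le_div_iff₀ (by positivity)]
      linarith
  refine ⟨a₁, a₂, fun k => ⟨hd₁ k, hd₂ k, hI₁ k, hI₂ k⟩, ?_⟩
  intro G₁ G₂ F₁₁ F₁₂ F₂₁ F₂₂ hbound hG₁ hG₂ hF₁₁ hF₁₂ hF₂₁ hF₂₂ hend
  obtain ⟨M', hM'⟩ := hbound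
  set M : ℝ := max M' 0
  have hM0 : 0 ≤ M := le_max_right _ _
  have hMG : ∀ x ∈ Pset, ∀ t ∈ Icc (0:ℝ) T, |G₁ x t| ≤ M ∧ |G₂ x t| ≤ M := fun x hx t ht =>
    ⟨(hM' x hx t ht).1.trans (le_max_left _ _), (hM' x hx t ht).2.1.trans (le_max_left _ _)⟩
  have hMF : ∀ x ∈ Pset, ∀ t ∈ Icc (0:ℝ) T, ∀ a ∈ Icc (-1:ℝ) 1,
      |F₁₁ x t a| ≤ M ∧ |F₁₂ x t a| ≤ M ∧ |F₂₁ x t a| ≤ M ∧ |F₂₂ x t a| ≤ M := by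
    intro x hx t ht a ha
    obtain ⟨h1, h2, h3, h4⟩ := (hM' x hx t ht).2.2 a ha
    exact ⟨h1.trans (le_max_left _ _), h2.trans (le_max_left _ _), h3.trans (le_max_left _ _),
      h4.trans (le_max_left _ _)⟩
  have h1mem : (1:ℝ) ∈ Icc (-1:ℝ) 1 := by norm_num
  have h0mem : (0:ℝ) ∈ Icc (-1:ℝ) 1 := by norm_num
  have hfix : ∀ {F : Pt → ℝ → ℝ → ℝ} {c : ℝ}, c ∈ Icc (-1:ℝ) 1 →
      UniformContinuousOn (fun z : (Pt × ℝ) × ℝ => F z.1.1 z.1.2 z.2)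
        ((Pset ×ˢ Icc (0:ℝ) T) ×ˢ Icc (-1:ℝ) 1) →
      UniformContinuousOn (fun z : Pt × ℝ => F z.1 z.2 c) (Pset ×ˢ Icc (0:ℝ) T) := by
    intro F c hc hF
    exact hF.comp (g := fun z : (Pt × ℝ) × ℝ => F z.1.1 z.1.2 z.2)
      (f := fun z : Pt × ℝ => (z, c))
      (uniformContinuous_id.prodMk uniformContinuous_const).uniformContinuousOn
      fun z hz => ⟨hz, hc⟩
  have hcomp : ∀ {F : Pt → ℝ → ℝ → ℝ} {a : ℝ → ℝ} {x : Pt}, x ∈ Pset → Continuous a →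
      (∀ s, a s ∈ Icc (-1:ℝ) 1) →
      UniformContinuousOn (fun z : (Pt × ℝ) × ℝ => F z.1.1 z.1.2 z.2)
        ((Pset ×ˢ Icc (0:ℝ) T) ×ˢ Icc (-1:ℝ) 1) →
      ContinuousOn (fun s => F x s (a s)) (Icc 0 T) := by
    intro F a x hx hac haI hF
    exact hF.continuousOn.comp (f := fun s : ℝ => ((x, s), a s)) (by fun_prop)
      fun s hs => ⟨⟨hx, hs⟩, haI s⟩
  constructor
  · have key := tendstoUniformlyOn_integral_of_oscillating (S := Pset) (C := 7 * M) (M := 4 * M)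
      (a := a₂) (β := β)
      (g := fun x s => G₂ x s + F₂₂ x s 1 + (1 / 2) * (F₂₁ x s 1 + F₂₁ x s 0))
      (L := fun x s => (1 / 2) * (F₂₁ x s 1 - F₂₁ x s 0))
      (Φ := fun k x s => a₂ k s * (G₂ x s + F₂₁ x s (a₁ k s) + F₂₂ x s (a₂ k s)))
      hT.le hc₂ hb₂ hp₂ (hlim _) hβc hβ0 hβlim
      ((hG₂.add_fun (hfix h1mem hF₂₂)).add_fun
        ((uniformContinuous_const_smul (1 / 2 : ℝ)).comp_uniformContinuousOn
          ((hfix h1mem hF₂₁).add_fun (hfix h0mem hF₂₁))))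
      (by positivity) (by positivity) ?_ ?_ ?_ ?_
    · simpa only [intervalIntegral.integral_const_mul] using key
    · intro x hx s hs
      have h1 := (hMG x hx s hs).2
      obtain ⟨-, -, h2, h3⟩ := hMF x hx s hs 1 h1mem
      obtain ⟨-, -, h4, -⟩ := hMF x hx s hs 0 h0mem
      rw [abs_le] at *
      constructor <;> linarith [h1.1, h1.2, h2.1, h2.2, h3.1, h3.2, h4.1, h4.2]
    · intro k x hx
      exact (hc₂ k).continuousOn.mul (((hG₂.comp_prodMk_slice hx).add
        (hcomp hx (hc₁ k) (hI₁ k) hF₂₁)).add (hcomp hx (hc₂ k) (hI₂ k) hF₂₂))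
    · intro x hx
      exact continuousOn_const.mul ((hcomp hx continuous_const (fun _ => h1mem) hF₂₁).sub
        (hcomp hx continuous_const (fun _ => h0mem) hF₂₁))
    · intro k x hx s hs
      obtain ⟨-, -, he1, he2⟩ := hend x hx s hs
      rcases hcases k s with h | ⟨h2, h1 | h1⟩ | ⟨h2, h1⟩
      · refine le_trans ?_ (le_mul_of_one_le_right (by positivity) h)
        obtain ⟨-, -, q1, -⟩ := hMF x hx s hs 1 h1mem
        obtain ⟨-, -, q2, -⟩ := hMF x hx s hs 0 h0mem
        obtain ⟨-, -, q3, -⟩ := hMF x hx s hs _ (hI₁ k s)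
        obtain ⟨-, -, -, q4⟩ := hMF x hx s hs _ (hI₂ k s)
        obtain ⟨-, -, -, q5⟩ := hMF x hx s hs 1 h1mem
        have hrw : a₂ k s * (G₂ x s + F₂₁ x s (a₁ k s) + F₂₂ x s (a₂ k s))
            - 1 / 2 * (F₂₁ x s 1 - F₂₁ x s 0)
            - a₂ k s * (G₂ x s + F₂₂ x s 1 + 1 / 2 * (F₂₁ x s 1 + F₂₁ x s 0))
            = a₂ k s * (F₂₁ x s (a₁ k s) + F₂₂ x s (a₂ k s) - F₂₂ x s 1
              - 1 / 2 * (F₂₁ x s 1 + F₂₁ x s 0)) - 1 / 2 * (F₂₁ x s 1 - F₂₁ x s 0) := by ring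
        have ha : |a₂ k s * (F₂₁ x s (a₁ k s) + F₂₂ x s (a₂ k s) - F₂₂ x s 1
              - 1 / 2 * (F₂₁ x s 1 + F₂₁ x s 0))| ≤ 1 * (4 * M) := by
          rw [abs_mul]
          refine mul_le_mul (hb₂ k s) ?_ (abs_nonneg _) zero_le_one
          rw [abs_le] at *
          constructor <;> linarith [q1.1, q1.2, q2.1, q2.2, q3.1, q3.2, q4.1, q4.2, q5.1, q5.2]
        rw [hrw]
        rw [abs_le] at *
        constructor <;> linarith [q1.1, q1.2, q2.1, q2.2, ha.1, ha.2]
      all_goals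
        refine le_trans (le_of_eq ?_) (mul_nonneg (by positivity) (hβ0 k s))
        rw [abs_eq_zero, h1, h2]
        first
          | ring1
          | (rw [he1]; ring1)
          | (rw [he2]; ring1)
  · have key := tendstoUniformlyOn_integral_of_oscillating (S := Pset) (C := 4 * M) (M := 3 * M)
      (a := a₁) (β := β)
      (g := fun x s => G₁ x s + F₁₁ x s 1 + F₁₂ x s 1)
      (L := fun _ _ => 0)
      (Φ := fun k x s => a₁ k s * (G₁ x s + F₁₁ x s (a₁ k s) + F₁₂ x s (a₂ k s)))
      hT.le hc₁ hb₁ hp₁ (hlim _) hβc hβ0 hβlim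
      ((hG₁.add_fun (hfix h1mem hF₁₁)).add_fun (hfix h1mem hF₁₂))
      (by positivity) (by positivity) ?_ ?_ ?_ ?_
    · simpa only [intervalIntegral.integral_zero] using key
    · intro x hx s hs
      have h1 := (hMG x hx s hs).1
      obtain ⟨h2, h3, -, -⟩ := hMF x hx s hs 1 h1mem
      rw [abs_le] at *
      constructor <;> linarith [h1.1, h1.2, h2.1, h2.2, h3.1, h3.2]
    · intro k x hx
      exact (hc₁ k).continuousOn.mul (((hG₁.comp_prodMk_slice hx).add
        (hcomp hx (hc₁ k) (hI₁ k) hF₁₁)).add (hcomp hx (hc₂ k) (hI₂ k) hF₁₂))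
    · intro x hx
      exact continuousOn_const
    · intro k x hx s hs
      obtain ⟨he1, -, -, -⟩ := hend x hx s hs
      rcases hcases k s with h | ⟨h2, h1 | h1⟩ | ⟨h2, h1⟩
      · refine le_trans ?_ (le_mul_of_one_le_right (by positivity) h)
        obtain ⟨q1, q2, -, -⟩ := hMF x hx s hs 1 h1mem
        obtain ⟨q3, -, -, -⟩ := hMF x hx s hs _ (hI₁ k s)
        obtain ⟨-, q4, -, -⟩ := hMF x hx s hs _ (hI₂ k s)
        have hrw : a₁ k s * (G₁ x s + F₁₁ x s (a₁ k s) + F₁₂ x s (a₂ k s)) - 0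
            - a₁ k s * (G₁ x s + F₁₁ x s 1 + F₁₂ x s 1)
            = a₁ k s * (F₁₁ x s (a₁ k s) + F₁₂ x s (a₂ k s) - F₁₁ x s 1 - F₁₂ x s 1) := by ring
        rw [hrw, abs_mul, ← one_mul (4 * M)]
        refine mul_le_mul (hb₁ k s) ?_ (abs_nonneg _) zero_le_one
        rw [abs_le] at *
        constructor <;> linarith [q1.1, q1.2, q2.1, q2.2, q3.1, q3.2, q4.1, q4.2]
      all_goals
        refine le_trans (le_of_eq ?_) (mul_nonneg (by positivity) (hβ0 k s))
        rw [abs_eq_zero, h1, h2]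
        first
          | ring1
          | (rw [he1]; ring1)
end
end

section
/- Given d, r, ε > 0 with d > r and ε < 1/10, there exists v₂ = (v₂₁,v₂₂) ∈ C₀^∞(P;ℝ²) such that: (i) div(x₂ v₂(x₁,x₂)) = 0 on P; (ii) supp v₂ ⊂ (−d,d) × (0.005εr, r) ∖ [−(d−r), d−r] × [εr, r/10]; (iii) |v₂₂| < ε/2 and −ε² ≤ v₂₁ ≤ 1 everywhere, with v₂₁ ≥ 0 and v₂₂ = 0 on [−(d−r), d−r] × (0, εr); (iv) v₂ = (1,0) on [−(d−r), d−r] × [0.02εr, 0.98εr]. -/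
noncomputable section

open MeasureTheory Real Set Filter Topology

/-- A smooth bump `f` on `[a, b]`, with plateau `[a + δ, b - δ]`, and a primitive `F` of `w * f`. -/
theorem exists_bump_primitive {w W : ℝ → ℝ} (hw : ContDiff ℝ (⊤ : ℕ∞) w)
    (hW : ∀ x, HasDerivAt W (w x) x) (hw0 : ∀ x, 0 ≤ x → 0 ≤ w x) {a b δ : ℝ} (ha : 0 ≤ a)
    (hδ : 0 < δ) (hab : a + 2 * δ < b) :
    ∃ f F : ℝ → ℝ, ContDiff ℝ (⊤ : ℕ∞) f ∧ ContDiff ℝ (⊤ : ℕ∞) F ∧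
      (∀ x, HasDerivAt F (w x * f x) x) ∧ (∀ x, 0 ≤ f x) ∧ (∀ x, f x ≤ 1) ∧
      (∀ x, a + δ ≤ x → x ≤ b - δ → f x = 1) ∧ (∀ x, f x ≠ 0 → a < x ∧ x < b) ∧
      (∀ x, x ≤ a → F x = 0) ∧ (∀ x, b ≤ x → F x = F b) ∧
      (∀ x, 0 ≤ F x) ∧ (∀ x, F x ≤ F b) ∧
      W (b - δ) - W (a + δ) ≤ F b ∧ (∀ x, 0 ≤ x → F x ≤ W x - W 0) := by
  let f : ContDiffBump ((a + b) / 2) :=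
    ⟨(b - a) / 2 - δ, (b - a) / 2, by linarith, by linarith⟩
  have hfs : ContDiff ℝ (⊤ : ℕ∞) f := f.contDiff
  have hf1 : ∀ x, a + δ ≤ x → x ≤ b - δ → f x = 1 := by
    intro x h1 h2
    apply f.one_of_mem_closedBall
    rw [Metric.mem_closedBall, Real.dist_eq, abs_le]
    constructor <;> simp only [f] <;> linarith
  have hf0 : ∀ x, f x ≠ 0 → a < x ∧ x < b := by
    intro x hx
    have : x ∈ Function.support f := hx
    rw [f.support_eq, Metric.mem_ball, Real.dist_eq, abs_lt] at this
    simp only [f] at this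
    constructor <;> linarith
  have hfz : ∀ x, x ≤ a ∨ b ≤ x → f x = 0 := by
    intro x hx
    by_contra h
    have := hf0 x h
    rcases hx with hx | hx <;> linarith
  have hcont : Continuous (fun x => w x * f x) := hw.continuous.mul hfs.continuous
  have hd : ∀ x, HasDerivAt (fun x => ∫ s in (0:ℝ)..x, w s * f s) (w x * f x) x := fun x =>
    hcont.integral_hasStrictDerivAt 0 x |>.hasDerivAt
  set F : ℝ → ℝ := fun x => ∫ s in (0:ℝ)..x, w s * f s with hF
  have hnn : ∀ x, 0 ≤ w x * f x := by
    intro x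
    by_cases h : f x = 0
    · simp [h]
    · exact mul_nonneg (hw0 x (by linarith [(hf0 x h).1])) f.nonneg
  have hmono : Monotone F := monotone_of_hasDerivAt_nonneg hd hnn
  have hsub : ∀ p q, ∫ s in p..q, w s * f s = F q - F p := fun p q =>
    intervalIntegral.integral_eq_sub_of_hasDerivAt (fun x _ => hd x)
      (hcont.intervalIntegrable _ _)
  have hWsub : ∀ p q, ∫ s in p..q, w s = W q - W p := fun p q =>
    intervalIntegral.integral_eq_sub_of_hasDerivAt (fun x _ => hW x)
      (hw.continuous.intervalIntegrable _ _)
  have hF0 : F 0 = 0 := by simp [hF]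
  have hleft : ∀ x, x ≤ a → F x = 0 := by
    intro x hx
    rw [hF]
    have : EqOn (fun s => w s * f s) (fun _ => (0:ℝ)) (uIcc 0 x) := by
      intro s hs
      have : s ≤ a := hs.2.trans (max_le ha hx)
      simp [hfz s (Or.inl this)]
    simp only [intervalIntegral.integral_congr this, intervalIntegral.integral_zero]
  have hright : ∀ x, b ≤ x → F x = F b := by
    intro x hx
    have : EqOn (fun s => w s * f s) (fun _ => (0:ℝ)) (uIcc b x) := by
      intro s hs
      rw [uIcc_of_le hx] at hs
      simp [hfz s (Or.inr hs.1)]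
    have h2 := hsub b x
    rw [intervalIntegral.integral_congr this, intervalIntegral.integral_zero] at h2
    linarith
  have hpos : ∀ x, 0 ≤ F x := by
    intro x
    rw [← hleft (min x a) (min_le_right _ _)]
    exact hmono (min_le_left _ _)
  refine ⟨f, F, hfs, ?_, hd, fun x => f.nonneg, fun x => f.le_one, hf1, hf0, hleft, hright,
    hpos, ?_, ?_, ?_⟩
  · rw [contDiff_infty_iff_deriv]
    refine ⟨fun x => (hd x).differentiableAt, ?_⟩
    rw [funext fun x => (hd x).deriv]
    exact hw.mul hfs
  · intro x
    rw [← hright (max x b) (le_max_right _ _)]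
    exact hmono (le_max_left _ _)
  · have h1 : EqOn (fun s => w s * f s) w (uIcc (a + δ) (b - δ)) := by
      intro s hs
      rw [uIcc_of_le (by linarith)] at hs
      simp [hf1 s hs.1 hs.2]
    rw [← hWsub, ← intervalIntegral.integral_congr h1, hsub]
    linarith [hpos (a + δ), hmono (show b - δ ≤ b by linarith)]
  · intro x hx
    rw [← hWsub, hF]
    refine intervalIntegral.integral_mono_on hx (hcont.intervalIntegrable _ _)
      (hw.continuous.intervalIntegrable _ _) fun s hs => ?_
    exact mul_le_of_le_one_right (hw0 s hs.1) f.le_one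

/-- A smooth plateau function: `1` near `[-(d - r), d - r]`, supported inside `(-d, d)`, with slope
close to the optimal `1 / r`. -/
theorem exists_plateau {d r : ℝ} (hdr : r < d) (hr : 0 < r) :
    ∃ X X' : ℝ → ℝ, ContDiff ℝ (⊤ : ℕ∞) X ∧ ContDiff ℝ (⊤ : ℕ∞) X' ∧
      (∀ x, HasDerivAt X (X' x) x) ∧ (∀ x, 0 ≤ X x) ∧ (∀ x, X x ≤ 1) ∧
      (∀ x, |x| ≤ d - r → X x = 1) ∧ (∀ x, X x ≠ 0 → |x| ≤ d - 0.001 * r) ∧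
      (∀ x, X' x ≠ 0 → d - 0.999 * r ≤ |x| ∧ |x| ≤ d - 0.001 * r) ∧
      (∀ x, |X' x| ≤ 1.01 / r) := by
  obtain ⟨k, S, hk, hS, hd, hk0, hk1, -, hks, hS0, hS1, hSn, hSb, hlow, -⟩ :=
    exists_bump_primitive (w := fun _ => 1) (W := fun x => x) contDiff_const
      (fun x => hasDerivAt_id' x) (fun _ _ => zero_le_one) (a := 0.001) (b := 0.999) (δ := 0.001)
      (by norm_num) (by norm_num) (by norm_num)
  set M := S 0.999 with hM
  have hMl : 0.996 ≤ M := by norm_num at hlow ⊢; linarith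
  have hMp : 0 < M := by linarith
  have ha : ∀ x, HasDerivAt (fun x => (d - x) / r) (-1 / r) x := fun x =>
    ((hasDerivAt_id' x).const_sub d).div_const r
  have hb : ∀ x, HasDerivAt (fun x => (d + x) / r) (1 / r) x := fun x =>
    ((hasDerivAt_id' x).const_add d).div_const r
  have hac : ContDiff ℝ (⊤ : ℕ∞) (fun x : ℝ => (d - x) / r) := by fun_prop
  have hbc : ContDiff ℝ (⊤ : ℕ∞) (fun x : ℝ => (d + x) / r) := by fun_prop
  have hone : ∀ x, 0.999 ≤ (d - x) / r ∨ 0.999 ≤ (d + x) / r := by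
    intro x
    rw [le_div_iff₀ hr, le_div_iff₀ hr]
    by_contra! h
    linarith [h.1, h.2]
  refine ⟨fun x => (S ((d - x) / r) + S ((d + x) / r)) / M - 1,
    fun x => (k ((d + x) / r) - k ((d - x) / r)) / (r * M), ?_, ?_, ?_, ?_, ?_, ?_, ?_, ?_, ?_⟩
  · exact (((hS.comp hac).add (hS.comp hbc)).div_const M).sub contDiff_const
  · exact ((hk.comp hbc).sub (hk.comp hac)).div_const _
  · intro x
    have := ((((hd _).comp x (ha x)).add ((hd _).comp x (hb x))).div_const M).sub_const 1
    refine this.congr_deriv ?_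
    field_simp
    ring
  · intro x
    have h1 := hSn ((d - x) / r)
    have h2 := hSn ((d + x) / r)
    rw [sub_nonneg, le_div_iff₀ hMp, one_mul]
    rcases hone x with h | h <;> rw [hS1 _ h] <;> linarith
  · intro x
    have h1 := hSb ((d - x) / r)
    have h2 := hSb ((d + x) / r)
    rw [sub_le_iff_le_add, div_le_iff₀ hMp]
    linarith
  · intro x hx
    rw [abs_le] at hx
    have h1 : 0.999 ≤ (d - x) / r := by rw [le_div_iff₀ hr]; linarith
    have h2 : 0.999 ≤ (d + x) / r := by rw [le_div_iff₀ hr]; linarith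
    simp only [hS1 _ h1, hS1 _ h2]
    field_simp
    ring
  · intro x hx
    by_contra! h
    apply hx
    rcases lt_abs.1 h with h | h
    · have h1 : (d - x) / r ≤ 0.001 := by rw [div_le_iff₀ hr]; linarith
      have h2 : 0.999 ≤ (d + x) / r := by rw [le_div_iff₀ hr]; linarith
      simp only [hS1 _ h2, hS0 _ h1]
      field_simp
      ring
    · have h1 : (d + x) / r ≤ 0.001 := by rw [div_le_iff₀ hr]; linarith
      have h2 : 0.999 ≤ (d - x) / r := by rw [le_div_iff₀ hr]; linarith
      simp only [hS1 _ h2, hS0 _ h1]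
      field_simp
      ring
  · intro x hx
    have h : k ((d + x) / r) ≠ 0 ∨ k ((d - x) / r) ≠ 0 := by
      by_contra! h
      simp [h.1, h.2] at hx
    rcases h with h | h
    · have := hks _ h
      rw [lt_div_iff₀ hr, div_lt_iff₀ hr] at this
      rw [abs_of_nonpos (by linarith [this.2])]
      constructor <;> linarith [this.1, this.2]
    · have := hks _ h
      rw [lt_div_iff₀ hr, div_lt_iff₀ hr] at this
      rw [abs_of_nonneg (by linarith [this.2])]
      constructor <;> linarith [this.1, this.2]
  · intro x
    have h : |k ((d + x) / r) - k ((d - x) / r)| ≤ 1 := by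
      rw [abs_le]
      constructor <;> linarith [hk0 ((d + x) / r), hk0 ((d - x) / r), hk1 ((d + x) / r),
        hk1 ((d - x) / r)]
    rw [abs_div, abs_of_pos (mul_pos hr hMp), div_le_div_iff₀ (mul_pos hr hMp) hr]
    nlinarith

/-- A smooth radial profile `g` with a compactly supported primitive `G` of `x * g x`, and
`Q = G / x`. -/
theorem exists_profile {r ε : ℝ} (hr : 0 < r) (hε : 0 < ε) (hε' : ε < 1 / 10) :
    ∃ g G Q : ℝ → ℝ, ContDiff ℝ (⊤ : ℕ∞) g ∧ ContDiff ℝ (⊤ : ℕ∞) Q ∧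
      (∀ x, HasDerivAt G (x * g x) x) ∧ (∀ x, x * Q x = G x) ∧
      (∀ x, -ε ^ 2 ≤ g x) ∧ (∀ x, g x ≤ 1) ∧ (∀ x, x ≤ ε * r → 0 ≤ g x) ∧
      (∀ x, 0.02 * ε * r ≤ x → x ≤ 0.98 * ε * r → g x = 1) ∧
      (∀ x, g x ≠ 0 → (0.015 * ε * r ≤ x ∧ x ≤ 0.985 * ε * r) ∨
        (0.102 * r ≤ x ∧ x ≤ 0.998 * r)) ∧
      (∀ x, Q x ≠ 0 → 0.015 * ε * r ≤ x ∧ x ≤ 0.998 * r) ∧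
      (∀ x, |Q x| ≤ 0.985 * ε * r / 2) := by
  have her : 0 < ε * r := mul_pos hε hr
  have her' : ε * r < r / 10 := by nlinarith
  have hW : ∀ x : ℝ, HasDerivAt (fun x : ℝ => x ^ 2 / 2) x x := fun x =>
    ((hasDerivAt_pow 2 x).div_const 2).congr_deriv (by simp)
  obtain ⟨p, A, hp, hA, hdA, hp0, hp1, hpp, hps, hA0, hA1, hAn, hAb, -, hAup⟩ :=
    exists_bump_primitive (w := fun x => x) contDiff_id hW (fun _ h => h)
      (a := 0.015 * (ε * r)) (b := 0.985 * (ε * r)) (δ := 0.005 * (ε * r))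
      (by linarith) (by linarith) (by linarith)
  obtain ⟨h, H, hh, hH, hdH, hh0, hh1, -, hhs, hH0, hH1, hHn, hHb, hHlow, -⟩ :=
    exists_bump_primitive (w := fun x => x) contDiff_id hW (fun _ h => h)
      (a := 0.102 * r) (b := 0.998 * r) (δ := 0.003 * r)
      (by linarith) (by linarith) (by linarith)
  set m := A (0.985 * (ε * r)) with hm
  set n := H (0.998 * r) with hn
  have hmn : m ≤ ε ^ 2 * n := by
    have h1 := hAup (0.985 * (ε * r)) (by linarith)
    have h2 : 0.979 / 2 * r ^ 2 ≤ n := by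
      refine le_trans (le_of_eq ?_) hHlow
      ring
    have h3 : ε ^ 2 * (0.979 / 2 * r ^ 2) ≤ ε ^ 2 * n := by gcongr
    refine le_trans ?_ h3
    refine h1.trans ?_
    nlinarith [sq_nonneg (ε * r)]
  have hnp : 0 < n := by
    have : 0.979 / 2 * r ^ 2 ≤ n := by
      refine le_trans (le_of_eq ?_) hHlow
      ring
    exact lt_of_lt_of_le (by positivity) this
  have hmnn : 0 ≤ m := hAn _
  set c := m / n with hc
  have hc0 : 0 ≤ c := div_nonneg hmnn hnp.le
  have hcε : c ≤ ε ^ 2 := by rwa [hc, div_le_iff₀ hnp]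
  have hcn : c * n = m := div_mul_cancel₀ _ hnp.ne'
  set g : ℝ → ℝ := fun x => p x - c * h x with hg
  set G : ℝ → ℝ := fun x => A x - c * H x with hG
  have hGleft : ∀ x, x ≤ 0.015 * (ε * r) → G x = 0 := by
    intro x hx
    simp [hG, hA0 x hx, hH0 x (by linarith)]
  have hGright : ∀ x, 0.998 * r ≤ x → G x = 0 := by
    intro x hx
    simp only [hG, hA1 x (by linarith), hH1 x hx]
    linarith
  have hGnn : ∀ x, 0 ≤ G x := by
    intro x
    simp only [hG]
    rcases le_total x (0.102 * r) with hx | hx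
    · simp [hH0 x hx, hAn x]
    · rw [hA1 x (by linarith)]
      have := mul_le_mul_of_nonneg_left (hHb x) hc0
      linarith
  have hGA : ∀ x, G x ≤ A x := fun x => by
    have := mul_nonneg hc0 (hHn x)
    simp only [hG]
    linarith
  have hGs : ContDiff ℝ (⊤ : ℕ∞) G := hA.sub (contDiff_const.mul hH)
  refine ⟨g, G, fun x => G x / x, hp.sub (contDiff_const.mul hh), ?_, ?_, ?_, ?_, ?_, ?_, ?_, ?_,
    ?_, ?_⟩
  · rw [contDiff_iff_contDiffAt]
    intro x
    by_cases hx : x = 0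
    · have : (fun x => G x / x) =ᶠ[𝓝 x] fun _ => 0 := by
        filter_upwards [Iio_mem_nhds (show x < 0.015 * (ε * r) by rw [hx]; linarith)] with y hy
        simp [hGleft y (le_of_lt hy)]
      exact contDiffAt_const.congr_of_eventuallyEq this
    · exact hGs.contDiffAt.div contDiffAt_id hx
  · intro x
    refine ((hdA x).sub ((hdH x).const_mul c)).congr_deriv ?_
    simp only [hg]
    ring
  · intro x
    by_cases hx : x = 0
    · rw [hGleft x (by rw [hx]; linarith), hx, zero_mul]
    · field_simp
  · intro x
    have := mul_le_mul_of_nonneg_left (hh1 x) hc0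
    simp only [hg]
    linarith [hp0 x]
  · intro x
    have := mul_nonneg hc0 (hh0 x)
    simp only [hg]
    linarith [hp1 x]
  · intro x hx
    have : h x = 0 := by
      by_contra h0
      linarith [(hhs x h0).1]
    simp [hg, this, hp0 x]
  · intro x h1 h2
    have : h x = 0 := by
      by_contra h0
      linarith [(hhs x h0).1]
    simp [hg, this, hpp x (by linarith) (by linarith)]
  · intro x hx
    have h0 : p x ≠ 0 ∨ h x ≠ 0 := by
      by_contra! h0
      simp [hg, h0.1, h0.2] at hx
    rcases h0 with h0 | h0
    · left
      have := hps x h0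
      constructor <;> linarith [this.1, this.2]
    · right
      have := hhs x h0
      constructor <;> linarith [this.1, this.2]
  · intro x hx
    have hx' : G x ≠ 0 := fun h0 => hx (by simp [h0])
    constructor
    · by_contra! h0
      exact hx' (hGleft x (by linarith))
    · by_contra! h0
      exact hx' (hGright x h0.le)
  · intro x
    rcases le_or_gt x 0 with hx | hx
    · simp only [hGleft x (by linarith), zero_div, abs_zero]
      linarith
    · rw [abs_of_nonneg (div_nonneg (hGnn x) hx.le), div_le_iff₀ hx]
      refine (hGA x).trans ?_
      rcases le_total x (0.985 * (ε * r)) with h1 | h1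
      · have := hAup x hx.le
        nlinarith
      · rw [hA1 x h1]
        have := hAup (0.985 * (ε * r)) (by linarith)
        nlinarith

theorem smoothCompSuppP_of_support_subset {g : Pt → ℝ} {K : Set Pt}
    (hg : ContDiff ℝ (⊤ : ℕ∞) g) (hK : IsCompact K) (hgK : ∀ p, g p ≠ 0 → p ∈ K)
    (hKP : K ⊆ Pset) : SmoothCompSuppP g ∧ tsupport g ⊆ K := by
  have h : tsupport g ⊆ K := closure_minimal hgK hK.isClosed
  exact ⟨⟨hg, hK.of_isClosed_subset (isClosed_tsupport g) h, h.trans hKP⟩, h⟩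

theorem pdx_prod {u v : ℝ → ℝ} {u' : ℝ} {p : Pt} (hu : HasDerivAt u u' p.1)
    (hv : DifferentiableAt ℝ v p.2) : pdx (fun q => u q.1 * v q.2) p = u' * v p.2 := by
  have h1 : HasFDerivAt (fun q : Pt => u q.1) _ p := hu.hasFDerivAt.comp p hasFDerivAt_fst
  have h2 : HasFDerivAt (fun q : Pt => v q.2) _ p :=
    hv.hasDerivAt.hasFDerivAt.comp p hasFDerivAt_snd
  rw [pdx, (h1.fun_mul h2).fderiv]
  simp [mul_comm]

theorem pdy_prod {u v : ℝ → ℝ} {v' : ℝ} {p : Pt} (hu : DifferentiableAt ℝ u p.1)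
    (hv : HasDerivAt v v' p.2) : pdy (fun q => u q.1 * v q.2) p = u p.1 * v' := by
  have h1 : HasFDerivAt (fun q : Pt => u q.1) _ p :=
    hu.hasDerivAt.hasFDerivAt.comp p hasFDerivAt_fst
  have h2 : HasFDerivAt (fun q : Pt => v q.2) _ p := hv.hasFDerivAt.comp p hasFDerivAt_snd
  rw [pdy, (h1.fun_mul h2).fderiv]
  simp

/-- Lemma 3.9: existence of the vector field `v₂`. -/
theorem statement_14 (d r ε : ℝ) (hdr : r < d) (hr : 0 < r) (hε : 0 < ε)
    (hε' : ε < 1 / 10) :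
    ∃ v₂₁ v₂₂ : Pt → ℝ,
      SmoothCompSuppP v₂₁ ∧ SmoothCompSuppP v₂₂ ∧
      (∀ p ∈ Pset, div2w v₂₁ v₂₂ p = 0) ∧
      (tsupport v₂₁ ∪ tsupport v₂₂ ⊆
        (Ioo (-d) d ×ˢ Ioo (0.005 * ε * r) r) \ (Icc (-(d - r)) (d - r) ×ˢ Icc (ε * r) (r / 10))) ∧
      (∀ p : Pt, |v₂₂ p| < ε / 2 ∧ -ε ^ 2 ≤ v₂₁ p ∧ v₂₁ p ≤ 1) ∧
      (∀ p ∈ Icc (-(d - r)) (d - r) ×ˢ Ioo (0:ℝ) (ε * r), 0 ≤ v₂₁ p ∧ v₂₂ p = 0) ∧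
      (∀ p ∈ Icc (-(d - r)) (d - r) ×ˢ Icc (0.02 * ε * r) (0.98 * ε * r),
        v₂₁ p = 1 ∧ v₂₂ p = 0) := by
  obtain ⟨X, X', hX, hX', hXd, hX0, hX1, hXone, hXs, hXs', hXb⟩ := exists_plateau hdr hr
  obtain ⟨g, G, Q, hg, hQ, hGd, hxQ, hgl, hgu, hgn, hgone, hgs, hQs, hQb⟩ :=
    exists_profile hr hε hε'
  have her : 0 < ε * r := mul_pos hε hr
  have her' : ε * r < r / 10 := by nlinarith
  have hX'0 : ∀ x ∈ Icc (-(d - r)) (d - r), X' x = 0 := by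
    intro x hx
    by_contra h
    have h1 : |x| ≤ d - r := abs_le.2 hx
    linarith [(hXs' x h).1]
  have habs : IsCompact {x : ℝ | |x| ≤ d - 0.001 * r} := by
    have : {x : ℝ | |x| ≤ d - 0.001 * r} = Icc (-(d - 0.001 * r)) (d - 0.001 * r) := by
      ext x
      simp [abs_le]
    rw [this]
    exact isCompact_Icc
  have hfar : IsClosed {x : ℝ | d - 0.999 * r ≤ |x|} :=
    isClosed_le continuous_const continuous_abs
  have h1 : SmoothCompSuppP (fun q => X q.1 * g q.2) ∧ tsupport (fun q : Pt => X q.1 * g q.2) ⊆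
      {x : ℝ | |x| ≤ d - 0.001 * r} ×ˢ
        (Icc (0.015 * ε * r) (0.985 * ε * r) ∪ Icc (0.102 * r) (0.998 * r)) := by
    apply smoothCompSuppP_of_support_subset
    · exact (hX.comp contDiff_fst).mul (hg.comp contDiff_snd)
    · exact habs.prod (isCompact_Icc.union isCompact_Icc)
    · intro p hp
      exact ⟨hXs _ (left_ne_zero_of_mul hp), hgs _ (right_ne_zero_of_mul hp)⟩
    · rintro p ⟨-, hp | hp⟩ <;> simp only [Pset, mem_ofPred_eq] <;> linarith [hp.1]
  have h2 : SmoothCompSuppP (fun q => -X' q.1 * Q q.2) ∧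
      tsupport (fun q : Pt => -X' q.1 * Q q.2) ⊆
      ({x : ℝ | |x| ≤ d - 0.001 * r} ∩ {x : ℝ | d - 0.999 * r ≤ |x|}) ×ˢ
        Icc (0.015 * ε * r) (0.998 * r) := by
    apply smoothCompSuppP_of_support_subset
    · exact (hX'.comp contDiff_fst).neg.mul (hQ.comp contDiff_snd)
    · exact (habs.inter_right hfar).prod isCompact_Icc
    · intro p hp
      have := hXs' _ (neg_ne_zero.1 (left_ne_zero_of_mul hp))
      exact ⟨⟨this.2, this.1⟩, hQs _ (right_ne_zero_of_mul hp)⟩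
    · rintro p ⟨-, hp⟩
      simp only [Pset, mem_ofPred_eq]
      linarith [hp.1]
  refine ⟨fun q => X q.1 * g q.2, fun q => -X' q.1 * Q q.2, h1.1, h2.1, ?_, ?_, ?_, ?_, ?_⟩
  · intro p _
    have e1 : (fun q : Pt => q.2 * (X q.1 * g q.2)) = fun q => X q.1 * (q.2 * g q.2) := by
      funext q
      ring
    have e2 : (fun q : Pt => q.2 * (-X' q.1 * Q q.2)) = fun q => -X' q.1 * G q.2 := by
      funext q
      rw [← hxQ]
      ring
    have hgd : DifferentiableAt ℝ (fun y => y * g y) p.2 :=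
      differentiableAt_id.mul (hg.differentiable (by simp) _)
    have hXd' : DifferentiableAt ℝ (fun x => -X' x) p.1 :=
      (hX'.differentiable (by simp) _).neg
    rw [div2w, e1, e2, pdx_prod (v := fun y => y * g y) (hXd p.1) hgd,
      pdy_prod (u := fun x => -X' x) hXd' (hGd p.2)]
    ring
  · refine union_subset (h1.2.trans ?_) (h2.2.trans ?_)
    · rintro p ⟨hp, hp' | hp'⟩
      · have hp : _ ∧ _ := abs_le.1 (mem_ofPred.1 hp)
        refine ⟨⟨⟨by linarith [hp.1], by linarith [hp.2]⟩, by linarith [hp'.1],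
          by linarith [hp'.2]⟩, fun h => ?_⟩
        linarith [hp'.2, h.2.1]
      · have hp : _ ∧ _ := abs_le.1 (mem_ofPred.1 hp)
        refine ⟨⟨⟨by linarith [hp.1], by linarith [hp.2]⟩, by linarith [hp'.1],
          by linarith [hp'.2]⟩, fun h => ?_⟩
        linarith [hp'.1, h.2.2]
    · rintro p ⟨⟨hp, hq⟩, hp'⟩
      have hp : _ ∧ _ := abs_le.1 (mem_ofPred.1 hp)
      refine ⟨⟨⟨by linarith [hp.1], by linarith [hp.2]⟩, by linarith [hp'.1],
          by linarith [hp'.2]⟩, fun h => ?_⟩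
      have h3 : |p.1| ≤ d - r := abs_le.2 h.1
      simp only [mem_ofPred_eq] at hq
      linarith
  · intro p
    refine ⟨?_, ?_, ?_⟩
    · rw [abs_mul, abs_neg]
      calc |X' p.1| * |Q p.2| ≤ 1.01 / r * (0.985 * ε * r / 2) :=
            mul_le_mul (hXb _) (hQb _) (abs_nonneg _) (by positivity)
        _ = 0.99485 * (ε / 2) := by
            field_simp
            norm_num
        _ < ε / 2 := by linarith
    · nlinarith [hX0 p.1, hX1 p.1, hgl p.2, sq_nonneg ε]
    · nlinarith [hX0 p.1, hX1 p.1, hgu p.2]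
  · intro p hp
    exact ⟨mul_nonneg (hX0 _) (hgn _ hp.2.2.le), by simp [hX'0 _ hp.1]⟩
  · intro p hp
    exact ⟨by simp [hXone _ (abs_le.2 hp.1), hgone _ hp.2.1 hp.2.2], by simp [hX'0 _ hp.1]⟩
end
end
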